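/- arXiv:1304.3280 — 2 statements merged into one kernel-verified Lean document; each statement's English description precedes it below -/
import Mathlib

section
/- Markov structure of the auxiliary variables in the Case-2 converse: under the coding setup below, for each i ∈ {1,...,n}, the random variables W and S₂,ᵢ are conditionally independent given (S₁,ᵢ, T₂, Y^{i−1}, S₁,ᵢ₊₁^n, S₂^{i−1}); equivalently, with Uᵢ = W and V₂,ᵢ = (T₂, Y^{i−1}, S₁,ᵢ₊₁^n, S₂^{i−1}), the Markov chain Uᵢ − (S₁,ᵢ, V₂,ᵢ) − S₂,ᵢ holds. -/
open scoped Classical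

/-- The probability of the event `f = a` under the pmf `P` on a finite space. -/
noncomputable def pr {Ω A : Type*} [Fintype Ω] (P : Ω → ℝ) (f : Ω → A) (a : A) : ℝ :=
  ∑ ω, if f ω = a then P ω else 0

/-- Shannon entropy `H(f)` (convention `0 log 0 = 0`, automatic since `Real.log 0 = 0`). -/
noncomputable def ent {Ω A : Type*} [Fintype Ω] [Fintype A] (P : Ω → ℝ) (f : Ω → A) : ℝ :=
  -∑ a, pr P f a * Real.log (pr P f a)

/-- Mutual information `I(f;g) = H(f) + H(g) − H(f,g)`. -/
noncomputable def mi {Ω A B : Type*} [Fintype Ω] [Fintype A] [Fintype B]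
    (P : Ω → ℝ) (f : Ω → A) (g : Ω → B) : ℝ :=
  ent P f + ent P g - ent P (fun ω => (f ω, g ω))

/-- Conditional mutual information `I(f;g|h) = H(f,h) + H(g,h) − H(f,g,h) − H(h)`. -/
noncomputable def cmi {Ω A B C : Type*} [Fintype Ω] [Fintype A] [Fintype B] [Fintype C]
    (P : Ω → ℝ) (f : Ω → A) (g : Ω → B) (h : Ω → C) : ℝ :=
  ent P (fun ω => (f ω, h ω)) + ent P (fun ω => (g ω, h ω)) -
    ent P (fun ω => (f ω, g ω, h ω)) - ent P h

/-- The prefix tuple `A^{i-1} = (A₁, …, A_{i−1})` of a finite sequence of random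
variables (as a single random variable). -/
def pre {Ω A : Type*} {n : ℕ} (f : Fin n → Ω → A) (i : Fin n) :
    Ω → (Fin i.val → A) :=
  fun ω j => f ⟨j.val, j.isLt.trans i.isLt⟩ ω

/-- The suffix tuple `A_{i+1}^n = (A_{i+1}, …, A_n)` of a finite sequence of random
variables (as a single random variable). -/
def suf {Ω A : Type*} {n : ℕ} (f : Fin n → Ω → A) (i : Fin n) :
    Ω → (Fin (n - (i.val + 1)) → A) :=
  fun ω j => f ⟨i.val + 1 + j.val, by have h1 := j.isLt; have h2 := i.isLt; omega⟩ ω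

/-- Independence of two random variables on a finite pmf space. -/
def IndepRV {Ω A B : Type*} [Fintype Ω]
    (P : Ω → ℝ) (f : Ω → A) (g : Ω → B) : Prop :=
  ∀ a b, pr P (fun ω => (f ω, g ω)) (a, b) = pr P f a * pr P g b

/-- Conditional independence of `f` and `g` given `h` on a finite pmf space. -/
def CondIndepRV {Ω A B C : Type*} [Fintype Ω]
    (P : Ω → ℝ) (f : Ω → A) (g : Ω → B) (h : Ω → C) : Prop :=
  ∀ a b c,
    pr P (fun ω => (f ω, g ω, h ω)) (a, b, c) * pr P h c =
      pr P (fun ω => (f ω, h ω)) (a, c) * pr P (fun ω => (g ω, h ω)) (b, c)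

section CodingSetup

variable {Ω Wt Tt A1 A2 Xt Yt : Type*}
  [Fintype Ω] [Fintype Wt] [Fintype Tt] [Fintype A1] [Fintype A2] [Fintype Xt] [Fintype Yt]
  {n : ℕ}

/-- The Case-2 channel-coding setup: `(S₁,ᵢ,S₂,ᵢ)` i.i.d. with pmf `μ`; the message `W`
independent of `(S₁^n, S₂^n)`; `T₂ = f_v(S₂^n)`; `X^n = f(W, T₂, S₁^n)`; and the outputs
`Y₁,…,Yₙ` generated memorylessly through the channel `ch`, i.e.
`P(W=w, S₁^n=a, S₂^n=b, Y^n=y) = P(W=w, S₁^n=a, S₂^n=b) Πᵢ ch(yᵢ | xᵢ, aᵢ, bᵢ)` where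
`x = f(w, f_v(b), a)`. -/
structure Case2Setup (P : Ω → ℝ) (μ : A1 → A2 → ℝ)
    (ch : Yt → Xt → A1 → A2 → ℝ)
    (W : Ω → Wt) (T2 : Ω → Tt)
    (S1 : Fin n → Ω → A1) (S2 : Fin n → Ω → A2)
    (X : Fin n → Ω → Xt) (Y : Fin n → Ω → Yt)
    (fv : (Fin n → A2) → Tt)
    (f : Wt → Tt → (Fin n → A1) → Fin n → Xt) : Prop where
  hP0 : ∀ ω, 0 ≤ P ω
  hP1 : ∑ ω, P ω = 1
  hμ0 : ∀ a b, 0 ≤ μ a b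
  hμ1 : ∑ a, ∑ b, μ a b = 1
  hch0 : ∀ y x a b, 0 ≤ ch y x a b
  hch1 : ∀ x a b, ∑ y, ch y x a b = 1
  hiid : ∀ (a : Fin n → A1) (b : Fin n → A2),
    pr P (fun ω => ((fun i => S1 i ω), (fun i => S2 i ω))) (a, b) = ∏ i, μ (a i) (b i)
  hWind : ∀ (wv : Wt) (ab : (Fin n → A1) × (Fin n → A2)),
    pr P (fun ω => (W ω, ((fun i => S1 i ω), (fun i => S2 i ω)))) (wv, ab) =
      pr P W wv * pr P (fun ω => ((fun i => S1 i ω), (fun i => S2 i ω))) ab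
  hT2 : ∀ ω, T2 ω = fv (fun i => S2 i ω)
  hX : ∀ ω i, X i ω = f (W ω) (T2 ω) (fun j => S1 j ω) i
  hmem : ∀ (wv : Wt) (a : Fin n → A1) (b : Fin n → A2) (yv : Fin n → Yt),
    pr P (fun ω => (W ω, (fun i => S1 i ω), (fun i => S2 i ω), (fun i => Y i ω)))
        (wv, a, b, yv) =
      pr P (fun ω => (W ω, (fun i => S1 i ω), (fun i => S2 i ω))) (wv, a, b) *
        ∏ i, ch (yv i) (f wv (fv b) a i) (a i) (b i)

end CodingSetup

section MarginalPmf

variable {Ω A B C : Type*} [Fintype Ω]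

/-- The probability of an event determined by `F` is a sum of values of the pmf of `F`. -/
theorem pr_eq_sum_of_iff [Fintype A] (P : Ω → ℝ) (F : Ω → A) (q : A → Prop) {g : Ω → B} {b : B}
    (hq : ∀ ω, g ω = b ↔ q (F ω)) :
    pr P g b = ∑ x, if q x then pr P F x else 0 := by
  have hfiber : ∀ x, (if q x then pr P F x else 0) =
      ∑ ω, if F ω = x then (if q (F ω) then P ω else 0) else 0 := by
    intro x
    unfold pr
    split_ifs with hx
    · refine Finset.sum_congr rfl fun ω _ => ?_
      by_cases h : F ω = x <;> simp [h, hx]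
    · symm
      refine Finset.sum_eq_zero fun ω _ => ?_
      by_cases h : F ω = x <;> simp [h, hx]
  simp_rw [hfiber]
  rw [Finset.sum_comm]
  simp [pr, hq]

theorem pr_snd_eq_sum [Fintype A] (P : Ω → ℝ) (f : Ω → A) (g : Ω → B) (b : B) :
    pr P g b = ∑ a, pr P (fun ω => (f ω, g ω)) (a, b) := by
  unfold pr
  rw [Finset.sum_comm]
  refine Finset.sum_congr rfl fun ω _ => ?_
  by_cases h : g ω = b <;> simp [h]

theorem pr_fst_trd_eq_sum [Fintype B] (P : Ω → ℝ) (f : Ω → A) (g : Ω → B) (h : Ω → C)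
    (a : A) (c : C) :
    pr P (fun ω => (f ω, h ω)) (a, c) = ∑ b, pr P (fun ω => (f ω, g ω, h ω)) (a, b, c) := by
  unfold pr
  rw [Finset.sum_comm]
  refine Finset.sum_congr rfl fun ω _ => ?_
  by_cases h1 : f ω = a <;> by_cases h2 : h ω = c <;> simp [h1, h2]

/-- If the joint pmf of `(f, g)` on each fibre of `h` is a product, then `f` and `g` are
conditionally independent given `h`. -/
theorem CondIndepRV.of_factorization [Fintype A] [Fintype B]
    (P : Ω → ℝ) (f : Ω → A) (g : Ω → B) (h : Ω → C)
    (hfac : ∀ c, ∃ (G : A → ℝ) (H : B → ℝ), ∀ a b,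
      pr P (fun ω => (f ω, g ω, h ω)) (a, b, c) = G a * H b) :
    CondIndepRV P f g h := by
  intro a b c
  obtain ⟨G, H, hGH⟩ := hfac c
  have hf : ∀ a, pr P (fun ω => (f ω, h ω)) (a, c) = G a * ∑ b, H b := by
    intro a
    rw [pr_fst_trd_eq_sum P f g h, Finset.mul_sum]
    exact Finset.sum_congr rfl fun b _ => hGH a b
  have hg : pr P (fun ω => (g ω, h ω)) (b, c) = (∑ a, G a) * H b := by
    rw [pr_snd_eq_sum P f, Finset.sum_mul]
    exact Finset.sum_congr rfl fun a _ => hGH a b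
  have hh : pr P h c = (∑ a, G a) * ∑ b, H b := by
    rw [pr_snd_eq_sum P f, Finset.sum_mul]
    exact Finset.sum_congr rfl fun a _ => hf a
  rw [hGH, hf, hg, hh]
  ring

end MarginalPmf

theorem pre_eq_pre_iff {Ω A : Type*} {n : ℕ} (f : Fin n → Ω → A) (i : Fin n) (ω ω' : Ω) :
    pre f i ω = pre f i ω' ↔ ∀ j < i, f j ω = f j ω' := by
  constructor
  · intro h j hj
    exact congrFun h ⟨j.val, hj⟩
  · intro h
    funext j
    exact h _ (Fin.lt_def.2 j.isLt)

theorem suf_eq_suf_iff {Ω A : Type*} {n : ℕ} (f : Fin n → Ω → A) (i : Fin n) (ω ω' : Ω) :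
    suf f i ω = suf f i ω' ↔ ∀ j, i < j → f j ω = f j ω' := by
  constructor
  · intro h j hj
    have hj' : i.val < j.val := hj
    have hlt := j.isLt
    have hcongr := congrFun h ⟨j.val - (i.val + 1), by omega⟩
    have hidx : (⟨i.val + 1 + (j.val - (i.val + 1)), by omega⟩ : Fin n) = j :=
      Fin.ext (by simp only; omega)
    simpa only [suf, hidx] using hcongr
  · intro h
    funext j
    exact h _ (Fin.lt_def.2 (by simp only; omega))

/-- Summing a product of pmfs over all sequences with a prescribed prefix leaves the product
over the prefix. -/
theorem sum_prod_ite_prefix {Y : Type*} [Fintype Y] {n : ℕ} (k : Fin n → Y → ℝ)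
    (hk : ∀ j, ∑ y, k j y = 1) (i : Fin n) (y₀ : Fin n → Y) :
    (∑ y : Fin n → Y, if ∀ j < i, y j = y₀ j then ∏ j, k j (y j) else 0) =
      ∏ j, if j < i then k j (y₀ j) else 1 := by
  have hterm : ∀ y : Fin n → Y, (if ∀ j < i, y j = y₀ j then ∏ j, k j (y j) else 0) =
      ∏ j, if j < i → y j = y₀ j then k j (y j) else 0 := by
    intro y
    split_ifs with h
    · exact Finset.prod_congr rfl fun j _ => (if_pos (h j)).symm
    · push Not at h
      obtain ⟨j, hj, hne⟩ := h
      refine (Finset.prod_eq_zero (Finset.mem_univ j) ?_).symm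
      simp [hj, hne]
  simp_rw [hterm]
  rw [← Fintype.prod_sum fun j y => if j < i → y = y₀ j then k j y else 0]
  refine Finset.prod_congr rfl fun j _ => ?_
  by_cases hj : j < i <;> simp [hj, hk]

/-- Markov structure of the auxiliary variables in the Case-2 converse.
Under the coding setup, for each `i`, `W` and `S₂,ᵢ` are conditionally independent
given `(S₁,ᵢ, T₂, Y^{i−1}, S₁,ᵢ₊₁^n, S₂^{i−1})`; i.e. with `Uᵢ = W` and
`V₂,ᵢ = (T₂, Y^{i−1}, S₁,ᵢ₊₁^n, S₂^{i−1})` the Markov chain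
`Uᵢ − (S₁,ᵢ, V₂,ᵢ) − S₂,ᵢ` holds. -/
theorem case2_markov_structure {Ω Wt Tt A1 A2 Xt Yt : Type*}
    [Fintype Ω] [Fintype Wt] [Fintype Tt] [Fintype A1] [Fintype A2] [Fintype Xt]
    [Fintype Yt] {n : ℕ} (hn : 0 < n)
    (P : Ω → ℝ) (μ : A1 → A2 → ℝ) (ch : Yt → Xt → A1 → A2 → ℝ)
    (W : Ω → Wt) (T2 : Ω → Tt)
    (S1 : Fin n → Ω → A1) (S2 : Fin n → Ω → A2)
    (X : Fin n → Ω → Xt) (Y : Fin n → Ω → Yt)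
    (fv : (Fin n → A2) → Tt) (f : Wt → Tt → (Fin n → A1) → Fin n → Xt)
    (hsetup : Case2Setup P μ ch W T2 S1 S2 X Y fv f) :
    ∀ i : Fin n,
      CondIndepRV P W (S2 i)
        (fun ω => (S1 i ω, T2 ω, pre Y i ω, suf S1 i ω, pre S2 i ω)) := by
  intro i
  refine CondIndepRV.of_factorization P _ _ _ fun c => ?_
  by_cases hc : ∃ ω₀, (S1 i ω₀, T2 ω₀, pre Y i ω₀, suf S1 i ω₀, pre S2 i ω₀) = c
  swap
  · refine ⟨0, 0, fun w b => ?_⟩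
    simp only [Pi.zero_apply, mul_zero]
    refine Finset.sum_eq_zero fun ω _ => if_neg fun h => hc ⟨ω, ?_⟩
    exact (Prod.ext_iff.1 (Prod.ext_iff.1 h).2).2
  obtain ⟨ω₀, rfl⟩ := hc
  refine ⟨fun w => ∑ a : Fin n → A1, if ∀ j, i ≤ j → a j = S1 j ω₀ then
      pr P W w * ∏ j, (if j < i then
        μ (a j) (S2 j ω₀) * ch (Y j ω₀) (f w (T2 ω₀) a j) (a j) (S2 j ω₀) else 1) else 0,
    fun b₀ => ∑ b : Fin n → A2,
      if b i = b₀ ∧ fv b = T2 ω₀ ∧ ∀ j < i, b j = S2 j ω₀ then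
        ∏ j, (if j < i then 1 else μ (S1 j ω₀) (b j)) else 0, fun w b₀ => ?_⟩
  have hevent : ∀ ω,
      ((W ω, S2 i ω, S1 i ω, T2 ω, pre Y i ω, suf S1 i ω, pre S2 i ω) =
        (w, b₀, S1 i ω₀, T2 ω₀, pre Y i ω₀, suf S1 i ω₀, pre S2 i ω₀)) ↔
      (W ω = w ∧ (∀ j, i ≤ j → S1 j ω = S1 j ω₀) ∧
        (S2 i ω = b₀ ∧ fv (fun j => S2 j ω) = T2 ω₀ ∧ ∀ j < i, S2 j ω = S2 j ω₀) ∧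
        ∀ j < i, Y j ω = Y j ω₀) := by
    intro ω
    simp only [Prod.mk.injEq, pre_eq_pre_iff, suf_eq_suf_iff, le_iff_eq_or_lt, or_imp,
      forall_and, forall_eq', hsetup.hT2 ω]
    tauto
  rw [pr_eq_sum_of_iff P
    (fun ω => (W ω, (fun j => S1 j ω), (fun j => S2 j ω), (fun j => Y j ω)))
    (fun x => x.1 = w ∧ (∀ j, i ≤ j → x.2.1 j = S1 j ω₀) ∧
        (x.2.2.1 i = b₀ ∧ fv x.2.2.1 = T2 ω₀ ∧ ∀ j < i, x.2.2.1 j = S2 j ω₀) ∧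
        ∀ j < i, x.2.2.2 j = Y j ω₀) hevent]
  simp_rw [Fintype.sum_prod_type]
  rw [Finset.sum_eq_single w (fun w' _ hw' => by simp [hw']) (by simp), Finset.sum_mul_sum]
  refine Finset.sum_congr rfl fun a _ => Finset.sum_congr rfl fun b _ => ?_
  by_cases ha : ∀ j, i ≤ j → a j = S1 j ω₀
  swap
  · simp [ha]
  by_cases hb : b i = b₀ ∧ fv b = T2 ω₀ ∧ ∀ j < i, b j = S2 j ω₀
  swap
  · simp only [hb, false_and, and_false, if_false, Finset.sum_const_zero, mul_zero]
  simp only [if_pos ha, if_pos hb]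
  have hjoint : ∀ y : Fin n → Yt,
      pr P (fun ω => (W ω, (fun j => S1 j ω), (fun j => S2 j ω), (fun j => Y j ω))) (w, a, b, y) =
        pr P W w * (∏ j, μ (a j) (b j)) * ∏ j, ch (y j) (f w (fv b) a j) (a j) (b j) := by
    intro y
    rw [hsetup.hmem, hsetup.hWind, hsetup.hiid]
  have hsum := sum_prod_ite_prefix (fun j y => ch y (f w (fv b) a j) (a j) (b j))
    (fun j => hsetup.hch1 _ _ _) i (fun j => Y j ω₀)
  calc _ = ∑ y : Fin n → Yt, pr P W w * (∏ j, μ (a j) (b j)) *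
        (if ∀ j < i, y j = Y j ω₀ then ∏ j, ch (y j) (f w (fv b) a j) (a j) (b j) else 0) := by
        refine Finset.sum_congr rfl fun y _ => ?_
        rw [hjoint y, mul_ite, mul_zero]
        exact if_congr ⟨fun h => h.2.2.2, fun h => ⟨trivial, ha, hb, h⟩⟩ rfl rfl
    _ = pr P W w * ∏ j, (μ (a j) (b j) *
        if j < i then ch (Y j ω₀) (f w (fv b) a j) (a j) (b j) else 1) := by
        rw [← Finset.mul_sum, hsum, mul_assoc, ← Finset.prod_mul_distrib]
    _ = _ := by
        change _ = pr P W w * _ * _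
        rw [mul_assoc, ← Finset.prod_mul_distrib]
        congr 1
        refine Finset.prod_congr rfl fun j _ => ?_
        by_cases hj : j < i
        · simp only [if_pos hj, hb.2.1, hb.2.2 j hj, mul_one]
        · simp only [if_neg hj, ha j (not_lt.1 hj), mul_one, one_mul]
end

section
/- Conditional independence used in the Case-2 converse upper bound: under the coding setup below, for each i ∈ {1,...,n}, the pair (Y^{i−1}, S₁^{i−1}) is conditionally independent of S₂,ᵢ given (T₂, S₁,ᵢ^n, S₂^{i−1}). -/
open scoped Classical

/-- The suffix tuple `A_i^n = (A_i, …, A_n)` (including index `i`) of a finite sequence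
of random variables (as a single random variable). -/
def sufIncl {Ω A : Type*} {n : ℕ} (f : Fin n → Ω → A) (i : Fin n) :
    Ω → (Fin (n - i.val) → A) :=
  fun ω j => f ⟨i.val + j.val, by have h1 := j.isLt; have h2 := i.isLt; omega⟩ ω

section FinitePmf

variable {Ω A B C : Type*} [Fintype Ω]

theorem pr_congr (P : Ω → ℝ) {f : Ω → A} {g : Ω → B} {a : A} {b : B}
    (h : ∀ ω, f ω = a ↔ g ω = b) : pr P f a = pr P g b :=
  Finset.sum_congr rfl fun ω _ => if_congr (h ω) rfl rfl

theorem pr_eq_zero (P : Ω → ℝ) {f : Ω → A} {a : A} (h : ∀ ω, f ω ≠ a) : pr P f a = 0 :=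
  Finset.sum_eq_zero fun ω _ => if_neg (h ω)

theorem pr_eq_sum_pr_prod [Fintype B] (P : Ω → ℝ) (f : Ω → A) (g : Ω → B) (a : A) :
    pr P f a = ∑ b, pr P (fun ω => (f ω, g ω)) (a, b) := by
  unfold pr
  rw [Finset.sum_comm]
  refine Finset.sum_congr rfl fun ω _ => ?_
  by_cases h : f ω = a <;> simp [h]

/-- A joint pmf of the form `G(a,c) H(b,c)` makes the first two variables conditionally
independent given the third. -/
theorem condIndepRV_of_factor [Fintype A] [Fintype B] (P : Ω → ℝ)
    {f : Ω → A} {g : Ω → B} {h : Ω → C} (G : A → C → ℝ) (H : B → C → ℝ)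
    (hfac : ∀ a b c, pr P (fun ω => (f ω, g ω, h ω)) (a, b, c) = G a c * H b c) :
    CondIndepRV P f g h := by
  have hf : ∀ a c, pr P (fun ω => (f ω, h ω)) (a, c) = G a c * ∑ b, H b c := by
    intro a c
    rw [pr_eq_sum_pr_prod P _ g, Finset.mul_sum]
    refine Finset.sum_congr rfl fun b _ => ?_
    rw [← hfac]
    exact pr_congr P fun ω => by simp only [Prod.mk.injEq]; tauto
  have hg : ∀ b c, pr P (fun ω => (g ω, h ω)) (b, c) = (∑ a, G a c) * H b c := by
    intro b c
    rw [pr_eq_sum_pr_prod P _ f, Finset.sum_mul]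
    refine Finset.sum_congr rfl fun a _ => ?_
    rw [← hfac]
    exact pr_congr P fun ω => by simp only [Prod.mk.injEq]; tauto
  have hh : ∀ c, pr P h c = (∑ a, G a c) * ∑ b, H b c := by
    intro c
    rw [pr_eq_sum_pr_prod P _ f, Finset.sum_mul]
    refine Finset.sum_congr rfl fun a _ => ?_
    rw [← hf]
    exact pr_congr P fun ω => by simp only [Prod.mk.injEq]; tauto
  intro a b c
  rw [hfac, hf, hg, hh]
  ring

end FinitePmf

section Split

variable {A : Type*} {n : ℕ}

/-- The index of the `k`-th entry of the prefix before `i`. -/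
def preIdx (i : Fin n) (k : Fin i.val) : Fin n := ⟨k.val, k.isLt.trans i.isLt⟩

/-- The index of the `k`-th entry of the suffix starting at `i`. -/
def sufIdx (i : Fin n) (k : Fin (n - i.val)) : Fin n := ⟨i.val + k.val, by omega⟩

/-- The sequence with prefix `u` before `i` and suffix `v` from `i` on. -/
def joinAt (i : Fin n) (u : Fin i.val → A) (v : Fin (n - i.val) → A) (j : Fin n) : A :=
  if h : j.val < i.val then u ⟨j.val, h⟩ else v ⟨j.val - i.val, by omega⟩

@[simp]
theorem joinAt_preIdx (i : Fin n) (u : Fin i.val → A) (v : Fin (n - i.val) → A)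
    (k : Fin i.val) : joinAt i u v (preIdx i k) = u k := by
  simp [joinAt, preIdx]

@[simp]
theorem joinAt_sufIdx (i : Fin n) (u : Fin i.val → A) (v : Fin (n - i.val) → A)
    (k : Fin (n - i.val)) : joinAt i u v (sufIdx i k) = v k := by
  simp [joinAt, sufIdx]

theorem eq_joinAt_iff {Ω : Type*} (S : Fin n → Ω → A) (i : Fin n) (u : Fin i.val → A)
    (v : Fin (n - i.val) → A) (ω : Ω) :
    (fun j => S j ω) = joinAt i u v ↔ pre S i ω = u ∧ sufIncl S i ω = v := by
  constructor
  · intro h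
    constructor <;> funext k
    · exact (congrFun h (preIdx i k)).trans (joinAt_preIdx i u v k)
    · exact (congrFun h (sufIdx i k)).trans (joinAt_sufIdx i u v k)
  · rintro ⟨rfl, rfl⟩
    funext j
    by_cases h : j.val < i.val
    · simp [joinAt, h, pre]
    · simp only [joinAt, h, dite_false, sufIncl]
      congr 1
      ext
      simp only
      omega

theorem prod_eq_prod_preIdx_mul_prod_sufIdx {M : Type*} [CommMonoid M] (i : Fin n)
    (g : Fin n → M) :
    ∏ j, g j = (∏ k, g (preIdx i k)) * ∏ k, g (sufIdx i k) := by
  have h : i.val + (n - i.val) = n := by omega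
  rw [← (finCongr h).prod_comp g, Fin.prod_univ_add]
  rfl

end Split

/-- conditional independence used in the Case-2 converse upper bound.
Under the coding setup, for each `i`, the pair `(Y^{i−1}, S₁^{i−1})` is conditionally
independent of `S₂,ᵢ` given `(T₂, S₁,ᵢ^n, S₂^{i−1})`. -/
theorem case2_cond_indep {Ω Wt Tt A1 A2 Xt Yt : Type*}
    [Fintype Ω] [Fintype Wt] [Fintype Tt] [Fintype A1] [Fintype A2] [Fintype Xt]
    [Fintype Yt] {n : ℕ} (hn : 0 < n)
    (P : Ω → ℝ) (μ : A1 → A2 → ℝ) (ch : Yt → Xt → A1 → A2 → ℝ)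
    (W : Ω → Wt) (T2 : Ω → Tt)
    (S1 : Fin n → Ω → A1) (S2 : Fin n → Ω → A2)
    (X : Fin n → Ω → Xt) (Y : Fin n → Ω → Yt)
    (fv : (Fin n → A2) → Tt) (f : Wt → Tt → (Fin n → A1) → Fin n → Xt)
    (hsetup : Case2Setup P μ ch W T2 S1 S2 X Y fv f) :
    ∀ i : Fin n,
      CondIndepRV P (fun ω => (pre Y i ω, pre S1 i ω)) (S2 i)
        (fun ω => (T2 ω, sufIncl S1 i ω, pre S2 i ω)) := by
  intro i
  have hpos : 0 < n - i.val := by omega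
  have hS2 : ∀ ω, S2 i ω = sufIncl S2 i ω ⟨0, hpos⟩ := fun _ => rfl
  have hjoint : ∀ w a a' b b' y y',
      pr P (fun ω => (W ω, (fun j => S1 j ω), (fun j => S2 j ω), (fun j => Y j ω)))
          (w, joinAt i a a', joinAt i b b', joinAt i y y') =
        (pr P W w * ∏ k, μ (a k) (b k) *
            ch (y k) (f w (fv (joinAt i b b')) (joinAt i a a') (preIdx i k)) (a k) (b k)) *
          (∏ k, μ (a' k) (b' k)) *
          ∏ k, ch (y' k) (f w (fv (joinAt i b b')) (joinAt i a a') (sufIdx i k))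
            (a' k) (b' k) := by
    intro w a a' b b' y y'
    rw [hsetup.hmem, hsetup.hWind, hsetup.hiid, prod_eq_prod_preIdx_mul_prod_sufIdx i,
      prod_eq_prod_preIdx_mul_prod_sufIdx i]
    simp only [joinAt_preIdx, joinAt_sufIdx, Finset.prod_mul_distrib]
    ring
  have hch : ∀ (x : Fin (n - i.val) → Xt) (a : Fin (n - i.val) → A1)
      (b : Fin (n - i.val) → A2),
      ∑ y : Fin (n - i.val) → Yt, ∏ k, ch (y k) (x k) (a k) (b k) = 1 := by
    intro x a b
    rw [← Fintype.prod_sum fun k y => ch y (x k) (a k) (b k)]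
    simp [hsetup.hch1]
  refine condIndepRV_of_factor P
    (fun ya c => ∑ w, pr P W w * ∏ k, μ (ya.2 k) (c.2.2 k) *
      ch (ya.1 k) (f w c.1 (joinAt i ya.2 c.2.1) (preIdx i k)) (ya.2 k) (c.2.2 k))
    (fun s c => ∑ b' : Fin (n - i.val) → A2,
      if b' ⟨0, hpos⟩ = s ∧ fv (joinAt i c.2.2 b') = c.1 then ∏ k, μ (c.2.1 k) (b' k) else 0)
    ?_
  rintro ⟨y, a⟩ s ⟨t, a', b⟩
  dsimp only
  rw [pr_eq_sum_pr_prod P _ W, Finset.sum_mul]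
  refine Finset.sum_congr rfl fun w _ => ?_
  rw [pr_eq_sum_pr_prod P _ (sufIncl S2 i), Finset.mul_sum]
  refine Finset.sum_congr rfl fun b' _ => ?_
  split_ifs with hb
  · obtain ⟨rfl, rfl⟩ := hb
    rw [pr_eq_sum_pr_prod P _ (sufIncl Y i)]
    calc
      _ = ∑ y', pr P
          (fun ω => (W ω, (fun j => S1 j ω), (fun j => S2 j ω), (fun j => Y j ω)))
          (w, joinAt i a a', joinAt i b b', joinAt i y y') := by
        refine Finset.sum_congr rfl fun y' _ => pr_congr P fun ω => ?_
        simp only [Prod.mk.injEq, eq_joinAt_iff, hS2, hsetup.hT2]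
        constructor
        · tauto
        · rintro ⟨hw, ⟨ha, ha'⟩, ⟨hb, hb'⟩, hy, hy'⟩
          have hjoin := (eq_joinAt_iff S2 i b b' ω).2 ⟨hb, hb'⟩
          simp only [hjoin, hb']
          tauto
      _ = _ := by
        simp only [hjoint]
        rw [← Finset.mul_sum, hch, mul_one]
  · rw [mul_zero]
    refine pr_eq_zero P fun ω hω => hb ?_
    simp only [Prod.mk.injEq] at hω
    obtain ⟨⟨⟨-, hs, ht, -, hb₀⟩, -⟩, hb'⟩ := hω
    rw [← (eq_joinAt_iff S2 i b b' ω).2 ⟨hb₀, hb'⟩, ← hsetup.hT2, ← hb']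
    exact ⟨hs, ht⟩
end
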